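/- arXiv:2110.09368 — 2 statements merged into one kernel-verified Lean document; each statement's English description precedes it below -/
import Mathlib

section
/- For every real Δ with 0 < Δ < 1, the limit as t → 0⁺ of t · e^{πΔ/t} · (θ₃(e^{−πtΔ}) θ₃(e^{−πt/Δ}) − 1/t) equals 2. -/
open MeasureTheory

/-- The Jacobi theta function `θ₃(q) = Σ_{j∈ℤ} q^{j²}`. -/
noncomputable def theta3 (q : ℝ) : ℝ := ∑' j : ℤ, q ^ (j ^ 2)

open Filter Topology

theorem theta3_eq_one_add_two_mul_tsum {x : ℝ} (h0 : 0 ≤ x) (h1 : x < 1) :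
    theta3 x = 1 + 2 * x * ∑' n : ℕ, x ^ (n * (n + 2)) := by
  have hs : Summable fun n : ℕ => x ^ (n * (n + 2)) :=
    (summable_geometric_of_lt_one h0 h1).of_nonneg_of_le (fun n => by positivity)
      fun n => pow_le_pow_of_le_one h0 h1.le (by nlinarith)
  have hpos : HasSum (fun n : ℕ => x ^ (((n : ℤ) + 1) ^ 2))
      (x * ∑' n : ℕ, x ^ (n * (n + 2))) := by
    have hterm (n : ℕ) : x ^ (((n : ℤ) + 1) ^ 2) = x * x ^ (n * (n + 2)) := by
      rw [← pow_succ', ← zpow_natCast]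
      congr 1
      push_cast
      ring
    simpa only [hterm] using hs.hasSum.mul_left x
  have hneg : HasSum (fun n : ℕ => x ^ ((-((n : ℤ) + 1)) ^ 2))
      (x * ∑' n : ℕ, x ^ (n * (n + 2))) := by
    simpa only [neg_sq] using hpos
  have h := HasSum.of_add_one_of_neg_add_one (f := fun j : ℤ => x ^ (j ^ 2)) hpos hneg
  rw [theta3, h.tsum_eq]
  norm_num
  ring

theorem tendsto_theta3_sub_one_div :
    Tendsto (fun x : ℝ => (theta3 x - 1) / x) (𝓝[>] 0) (𝓝 2) := by
  have hsum : Tendsto (fun x : ℝ => ∑' n : ℕ, x ^ (n * (n + 2))) (𝓝[>] 0)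
      (𝓝 (∑' n : ℕ, (0 : ℝ) ^ (n * (n + 2)))) := by
    refine tendsto_tsum_of_dominated_convergence (bound := fun n => (1 / 2 : ℝ) ^ n)
      summable_geometric_two (fun n => ?_) ?_
    · exact ((continuous_pow (n * (n + 2))).tendsto 0).mono_left nhdsWithin_le_nhds
    · filter_upwards [Ioo_mem_nhdsGT (show (0 : ℝ) < 1 / 2 by norm_num)] with x hx n
      rw [Real.norm_of_nonneg (pow_nonneg hx.1.le _)]
      calc x ^ (n * (n + 2)) ≤ x ^ n :=
            pow_le_pow_of_le_one hx.1.le (by linarith [hx.2]) (by nlinarith)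
        _ ≤ (1 / 2) ^ n := pow_le_pow_left₀ hx.1.le hx.2.le n
  have hone : ∑' n : ℕ, (0 : ℝ) ^ (n * (n + 2)) = 1 := by
    rw [tsum_eq_single 0 fun n hn => zero_pow (by positivity)]
    simp
  rw [hone] at hsum
  have h2 := hsum.const_mul 2
  rw [mul_one] at h2
  refine h2.congr' ?_
  filter_upwards [Ioo_mem_nhdsGT (show (0 : ℝ) < 1 by norm_num)] with x hx
  rw [theta3_eq_one_add_two_mul_tsum hx.1.le hx.2]
  field_simp [hx.1.ne']
  ring

theorem tendsto_theta3_nhdsGT_zero : Tendsto theta3 (𝓝[>] 0) (𝓝 1) := by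
  have h := (tendsto_theta3_sub_one_div.mul
    (tendsto_id.mono_left (nhdsWithin_le_nhds (s := Set.Ioi (0 : ℝ))))).add_const 1
  rw [mul_zero, zero_add] at h
  refine h.congr' ?_
  filter_upwards [self_mem_nhdsWithin] with x hx
  have hx0 : x ≠ 0 := ne_of_gt hx
  simp only [id]
  field_simp
  ring

theorem theta3_exp_neg_pi_mul {a : ℝ} (ha : 0 < a) :
    theta3 (Real.exp (-(Real.pi * a))) =
      1 / √a * theta3 (Real.exp (-(Real.pi / a))) := by
  have h := Real.tsum_exp_neg_mul_int_sq ha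
  rw [← Real.sqrt_eq_rpow] at h
  simp only [theta3, ← Real.rpow_intCast, ← Real.exp_mul, Int.cast_pow]
  convert h using 5
  · ring
  · ring

theorem theta3_mul_theta3_functional_equation {Δ t : ℝ} (h0 : 0 < Δ) (ht : 0 < t) :
    theta3 (Real.exp (-(Real.pi * t * Δ))) * theta3 (Real.exp (-(Real.pi * t / Δ))) =
      1 / t * (theta3 (Real.exp (-(Real.pi / Δ * t⁻¹))) *
        theta3 (Real.exp (-(Real.pi * Δ * t⁻¹)))) := by
  have hsqrt : √(t * Δ) * √(t / Δ) = t := by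
    rw [← Real.sqrt_mul (by positivity), show t * Δ * (t / Δ) = t ^ 2 by field_simp,
      Real.sqrt_sq ht.le]
  rw [mul_assoc, mul_div_assoc, theta3_exp_neg_pi_mul (mul_pos ht h0),
    theta3_exp_neg_pi_mul (div_pos ht h0), mul_mul_mul_comm, one_div_mul_one_div, hsqrt,
    show Real.pi / (t * Δ) = Real.pi / Δ * t⁻¹ by field_simp,
    show Real.pi / (t / Δ) = Real.pi * Δ * t⁻¹ by field_simp]

theorem tendsto_exp_neg_mul_inv_nhdsGT_zero {c : ℝ} (hc : 0 < c) :
    Tendsto (fun t : ℝ => Real.exp (-(c * t⁻¹))) (𝓝[>] 0) (𝓝[>] 0) :=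
  tendsto_nhdsWithin_iff.2 ⟨Real.tendsto_exp_neg_atTop_nhds_zero.comp
    (tendsto_inv_nhdsGT_zero.const_mul_atTop hc), .of_forall fun _ => Real.exp_pos _⟩

/-- for `0 < Δ < 1`,
`lim_{t→0⁺} t e^{πΔ/t} (θ₃(e^{-πtΔ}) θ₃(e^{-πt/Δ}) - 1/t) = 2`. -/
theorem theta_smallt_asymptotics (Δ : ℝ) (h0 : 0 < Δ) (h1 : Δ < 1) :
    Filter.Tendsto (fun t : ℝ =>
        t * Real.exp (Real.pi * Δ / t) *
          (theta3 (Real.exp (-(Real.pi * t * Δ))) *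
            theta3 (Real.exp (-(Real.pi * t / Δ))) - 1 / t))
      (nhdsWithin 0 (Set.Ioi 0)) (nhds 2) := by
  have hπ := Real.pi_pos
  have hp := tendsto_exp_neg_mul_inv_nhdsGT_zero (div_pos hπ h0)
  have hq := tendsto_exp_neg_mul_inv_nhdsGT_zero (mul_pos hπ h0)
  have hlt : Real.pi * Δ < Real.pi / Δ := by
    rw [lt_div_iff₀ h0]
    nlinarith [mul_lt_mul_of_pos_left (show Δ * Δ < 1 by nlinarith) hπ]
  have hr := (tendsto_exp_neg_mul_inv_nhdsGT_zero (sub_pos.2 hlt)).mono_right nhdsWithin_le_nhds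
  have h := ((tendsto_theta3_nhdsGT_zero.comp hp).mul (tendsto_theta3_sub_one_div.comp hq)).add
    ((tendsto_theta3_sub_one_div.comp hp).mul hr)
  rw [one_mul, mul_zero, add_zero] at h
  refine h.congr' ?_
  filter_upwards [self_mem_nhdsWithin] with t ht
  have ht0 : 0 < t := ht
  rw [theta3_mul_theta3_functional_equation h0 ht0]
  simp only [Function.comp_apply]
  have hexp : Real.exp (-((Real.pi / Δ - Real.pi * Δ) * t⁻¹)) =
      Real.exp (-(Real.pi / Δ * t⁻¹)) / Real.exp (-(Real.pi * Δ * t⁻¹)) := by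
    rw [← Real.exp_sub]
    ring_nf
  have hinv : Real.exp (Real.pi * Δ / t) = (Real.exp (-(Real.pi * Δ * t⁻¹)))⁻¹ := by
    rw [← Real.exp_neg, neg_neg, div_eq_mul_inv]
  rw [hexp, hinv]
  generalize hP : Real.exp (-(Real.pi / Δ * t⁻¹)) = p
  generalize hQ : Real.exp (-(Real.pi * Δ * t⁻¹)) = q
  have hp0 : p ≠ 0 := hP ▸ Real.exp_ne_zero _
  have hq0 : q ≠ 0 := hQ ▸ Real.exp_ne_zero _
  field_simp
  ring
end

section
/- For every real Δ > 0 and every complex s, the function t ↦ (t^{s−1} + t^{−s}) (θ₃(e^{−πtΔ}) θ₃(e^{−πt/Δ}) − 1/t) is (Bochner) integrable on the interval (0,1). -/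
open MeasureTheory

open Filter Topology Asymptotics HurwitzZeta

theorem theta3_exp_eq_evenKernel {x : ℝ} (hx : 0 < x) :
    theta3 (Real.exp (-(Real.pi * x))) = evenKernel 0 x := by
  have h := (hasSum_int_evenKernel 0 hx).tsum_eq
  rw [QuotientAddGroup.mk_zero] at h
  rw [← h, theta3]
  refine tsum_congr fun n => ?_
  rw [← Real.rpow_intCast, ← Real.exp_mul]
  push_cast
  congr 1
  ring

theorem isBigO_evenKernel_zero_mul_sub_one {a : ℝ} (ha : 0 < a) (b : ℝ) :
    (fun u : ℝ => evenKernel 0 (u * a) - 1) =O[atTop] (fun u : ℝ => u ^ b) := by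
  obtain ⟨p, hp, h⟩ := isBigO_atTop_evenKernel_sub 0
  have h1 := h.comp_tendsto (tendsto_id.atTop_mul_const ha)
  have h2 := (isLittleO_exp_neg_mul_rpow_atTop (mul_pos hp ha) b).isBigO
  refine IsBigO.trans ?_ h2
  refine h1.congr (fun u => by simp) (fun u => ?_)
  simp only [Function.comp_apply, id]
  congr 1
  ring

theorem isBigO_evenKernel_zero_mul_evenKernel_zero_sub_one {a c : ℝ} (ha : 0 < a) (hc : 0 < c)
    (b : ℝ) :
    (fun u : ℝ => evenKernel 0 (u * a) * evenKernel 0 (u * c) - 1) =O[atTop]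
      (fun u : ℝ => u ^ b) := by
  have hbdd : (fun u : ℝ => evenKernel 0 (u * c)) =O[atTop] (fun _ : ℝ => (1 : ℝ)) := by
    have h := isBigO_evenKernel_zero_mul_sub_one hc 0
    simp only [Real.rpow_zero] at h
    exact (h.add (isBigO_refl (fun _ : ℝ => (1 : ℝ)) atTop)).congr_left fun u => by ring
  have h := ((isBigO_evenKernel_zero_mul_sub_one ha b).mul hbdd).add
    ((isBigO_evenKernel_zero_mul_sub_one hc b).congr_right fun u => (mul_one (u ^ b)).symm)
  exact h.congr (fun u => by ring) (fun u => mul_one _)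

theorem evenKernel_zero_mul_evenKernel_zero_sub_inv {Δ t : ℝ} (hΔ : 0 < Δ) (ht : 0 < t) :
    evenKernel 0 (t * Δ) * evenKernel 0 (t / Δ) - 1 / t =
      t⁻¹ * (evenKernel 0 (t⁻¹ * Δ⁻¹) * evenKernel 0 (t⁻¹ * Δ) - 1) := by
  rw [evenKernel_functional_equation 0 (t * Δ), evenKernel_functional_equation 0 (t / Δ),
    ← evenKernel_eq_cosKernel_of_zero]
  have h1 : 1 / (t * Δ) = t⁻¹ * Δ⁻¹ := by field_simp
  have h2 : 1 / (t / Δ) = t⁻¹ * Δ := by field_simp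
  have h3 : (t * Δ) ^ (1 / 2 : ℝ) * (t / Δ) ^ (1 / 2 : ℝ) = t := by
    rw [← Real.mul_rpow (by positivity) (by positivity)]
    have : t * Δ * (t / Δ) = t ^ 2 := by field_simp
    rw [this, ← Real.sqrt_eq_rpow, Real.sqrt_sq ht.le]
  rw [h1, h2, mul_mul_mul_comm, div_mul_div_comm, h3]
  ring

theorem isBigO_evenKernel_zero_mul_evenKernel_zero_sub_inv {Δ : ℝ} (hΔ : 0 < Δ) (b : ℝ) :
    (fun t : ℝ => evenKernel 0 (t * Δ) * evenKernel 0 (t / Δ) - 1 / t) =O[𝓝[>] 0]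
      (fun t : ℝ => t ^ b) := by
  have h := (isBigO_evenKernel_zero_mul_evenKernel_zero_sub_one (inv_pos.2 hΔ) hΔ
    (-(b + 1))).comp_tendsto tendsto_inv_nhdsGT_zero
  refine ((isBigO_refl (fun t : ℝ => t⁻¹) (𝓝[>] 0)).mul h).congr' ?_ ?_
  · filter_upwards [self_mem_nhdsWithin] with t ht
    exact (evenKernel_zero_mul_evenKernel_zero_sub_inv hΔ ht).symm
  · filter_upwards [self_mem_nhdsWithin] with t ht
    have ht : 0 < t := ht
    simp only [Function.comp_apply]
    rw [Real.inv_rpow ht.le, Real.rpow_neg ht.le, inv_inv, Real.rpow_add_one ht.ne']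
    field_simp

theorem integrableOn_Ioo_cpow_mul_of_isBigO {g : ℝ → ℝ} (hg : ContinuousOn g (Set.Ioi 0))
    (hO : ∀ b : ℝ, g =O[𝓝[>] 0] (fun t : ℝ => t ^ b)) (w : ℂ) :
    IntegrableOn (fun t : ℝ => (t : ℂ) ^ w * (g t : ℂ)) (Set.Ioo 0 1) := by
  set F : ℝ → ℂ := fun t => (t : ℂ) ^ w * (g t : ℂ)
  have hF : ContinuousOn F (Set.Ioi 0) := by
    refine ContinuousOn.mul (fun t ht => ?_) (Complex.continuous_ofReal.comp_continuousOn hg)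
    exact (Complex.continuousAt_ofReal_cpow_const t w (Or.inr (ne_of_gt ht))).continuousWithinAt
  have hF1 : F =O[𝓝[>] 0] (fun _ : ℝ => (1 : ℝ)) := by
    have hw : (fun t : ℝ => (t : ℂ) ^ w) =O[𝓝[>] 0] (fun t : ℝ => t ^ w.re) := by
      refine IsBigO.of_bound 1 ?_
      filter_upwards [self_mem_nhdsWithin] with t ht
      rw [Complex.norm_cpow_eq_rpow_re_of_pos ht, one_mul]
      exact le_abs_self _
    have hg' : (fun t : ℝ => (g t : ℂ)) =O[𝓝[>] 0] (fun t : ℝ => t ^ (-w.re)) :=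
      (hO _).norm_left.congr_left (fun t => (Complex.norm_real _).symm) |>.of_norm_left
    refine (hw.mul hg').congr' EventuallyEq.rfl ?_
    filter_upwards [self_mem_nhdsWithin] with t ht
    rw [← Real.rpow_add ht, add_neg_cancel, Real.rpow_zero]
  have hfil : IntegrableAtFilter F (𝓝[>] 0) := by
    refine hF1.integrableAtFilter
      ⟨Set.Ioi 0, self_mem_nhdsWithin, hF.aestronglyMeasurable measurableSet_Ioi⟩ ?_
    exact ⟨Set.Ioo 0 1, Ioo_mem_nhdsGT one_pos, integrableOn_const (by simp)⟩
  obtain ⟨S, hS, hint⟩ := hfil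
  obtain ⟨c, hc, hcS⟩ := mem_nhdsGT_iff_exists_Ioc_subset.1 hS
  have hc : 0 < c := hc
  have hIcc : IntegrableOn F (Set.Icc c 1) :=
    (hF.mono fun t ht => hc.trans_le ht.1).integrableOn_Icc
  refine ((hint.mono_set hcS).union hIcc).mono_set fun t ht => ?_
  rcases le_total t c with h | h
  · exact Or.inl ⟨ht.1, h⟩
  · exact Or.inr ⟨h, ht.2.le⟩

/-- for every `Δ > 0` and every complex `s`, the function
`t ↦ (t^{s-1} + t^{-s}) (θ₃(e^{-πtΔ}) θ₃(e^{-πt/Δ}) - 1/t)` is Bochner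
integrable on `(0,1)`. -/
theorem integrand_integrableOn (Δ : ℝ) (hΔ : 0 < Δ) (s : ℂ) :
    IntegrableOn (fun t : ℝ =>
        ((t : ℂ) ^ (s - 1) + (t : ℂ) ^ (-s)) *
          ((theta3 (Real.exp (-(Real.pi * t * Δ))) *
              theta3 (Real.exp (-(Real.pi * t / Δ))) - 1 / t : ℝ) : ℂ))
      (Set.Ioo 0 1) := by
  have hcont : ContinuousOn
      (fun t : ℝ => evenKernel 0 (t * Δ) * evenKernel 0 (t / Δ) - 1 / t) (Set.Ioi 0) := by
    refine ((continuousOn_evenKernel 0).comp (by fun_prop) fun t ht => mul_pos ht hΔ).mul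
      ((continuousOn_evenKernel 0).comp (by fun_prop) fun t ht => div_pos ht hΔ) |>.sub ?_
    exact continuousOn_const.div continuousOn_id fun t ht => ne_of_gt ht
  have hO := isBigO_evenKernel_zero_mul_evenKernel_zero_sub_inv hΔ
  refine ((integrableOn_Ioo_cpow_mul_of_isBigO hcont hO (s - 1)).add
    (integrableOn_Ioo_cpow_mul_of_isBigO hcont hO (-s))).congr_fun (fun t ht => ?_)
    measurableSet_Ioo
  simp only [Pi.add_apply]
  rw [mul_assoc Real.pi t Δ, mul_div_assoc Real.pi t Δ,
    theta3_exp_eq_evenKernel (mul_pos ht.1 hΔ), theta3_exp_eq_evenKernel (div_pos ht.1 hΔ),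
    add_mul]
end
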